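/- Let λ > 1 and let (b_n) satisfy b_{n+1} = λ b_n + K/n + r_n where |r_n| ≤ H/n² for all n ≥ 1, for constants K, H. If b_n → 0 as n → ∞, then b_n = -K/((λ-1)n) + O(1/n²) as n → ∞. -/

import Mathlib

open Filter

/-- A null sequence that grows at least geometrically with ratio `lam > 1` is never positive. -/
lemma nonpos_of_mul_le_succ_of_tendsto_zero {lam : ℝ} (hlam : 1 < lam) {d : ℕ → ℝ} {N : ℕ}
    (hd : ∀ n, N ≤ n → lam * d n ≤ d (n + 1)) (hd0 : Tendsto d atTop (nhds 0))
    {n : ℕ} (hn : N ≤ n) : d n ≤ 0 := by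
  by_contra! hpos
  have hmono : ∀ m, n ≤ m → d n ≤ d m := by
    intro m hm
    induction m, hm using Nat.le_induction with
    | base => exact le_rfl
    | succ m hm ih => nlinarith [hd m (hn.trans hm)]
  exact hpos.not_ge (ge_of_tendsto hd0 (eventually_atTop.2 ⟨n, hmono⟩))

/-- A null solution of `c (n + 1) = lam * c n + s n` with `lam > 1` and `|s n| ≤ M / n ^ 2`
satisfies `|c n| ≤ (M / (lam - 1)) / n ^ 2`. -/
lemma abs_le_div_sq_of_unstable_recurrence {lam M : ℝ} (hlam : 1 < lam) (hM : 0 ≤ M)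
    {c s : ℕ → ℝ} (hrec : ∀ n : ℕ, 1 ≤ n → c (n + 1) = lam * c n + s n)
    (hs : ∀ n : ℕ, 1 ≤ n → |s n| ≤ M / (n : ℝ) ^ 2) (hc0 : Tendsto c atTop (nhds 0))
    {n : ℕ} (hn : 1 ≤ n) : |c n| ≤ M / (lam - 1) / (n : ℝ) ^ 2 := by
  have hl : 0 < lam - 1 := sub_pos.2 hlam
  have hlim : Tendsto (fun n : ℕ => |c n| - M / (lam - 1) / (n : ℝ) ^ 2) atTop (nhds 0) := by
    have h1 : Tendsto (fun n : ℕ => M / (lam - 1) / (n : ℝ) ^ 2) atTop (nhds 0) :=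
      ((tendsto_pow_atTop two_ne_zero).comp tendsto_natCast_atTop_atTop).const_div_atTop _
    simpa using hc0.abs.sub h1
  refine sub_nonpos.1 (nonpos_of_mul_le_succ_of_tendsto_zero hlam (fun m hm => ?_) hlim hn)
  have hm0 : (0 : ℝ) < m := by exact_mod_cast hm
  have htri : lam * |c m| ≤ |c (m + 1)| + |s m| := by
    have h := abs_sub (c (m + 1)) (s m)
    rwa [hrec m hm, add_sub_cancel_right, abs_mul, abs_of_pos (by linarith : 0 < lam),
      ← hrec m hm] at h
  have hdec : M / (lam - 1) / ((m + 1 : ℕ) : ℝ) ^ 2 ≤ M / (lam - 1) / (m : ℝ) ^ 2 := by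
    gcongr
    exact m.le_succ
  have hsplit : M / (m : ℝ) ^ 2 = (lam - 1) * (M / (lam - 1) / (m : ℝ) ^ 2) := by
    field_simp
  have := hs m hm
  linarith

/-- Unstable component: if `b_{n+1} = λ b_n + K/n + r_n` with `λ > 1`,
`|r_n| ≤ H/n²`, and `b_n → 0`, then `b_n = -K/((λ-1)n) + O(1/n²)`. -/
theorem stmt11 (lam K H : ℝ) (hlam : 1 < lam)
    (b r : ℕ → ℝ)
    (hrec : ∀ n : ℕ, 1 ≤ n → b (n + 1) = lam * b n + K / n + r n)
    (hr : ∀ n : ℕ, 1 ≤ n → |r n| ≤ H / (n : ℝ) ^ 2)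
    (hb0 : Tendsto b atTop (nhds 0)) :
    ∃ C : ℝ, ∀ n : ℕ, 1 ≤ n →
      |b n - (-(K / ((lam - 1) * n)))| ≤ C / (n : ℝ) ^ 2 := by
  have hl : 0 < lam - 1 := sub_pos.2 hlam
  have hH : 0 ≤ H := by simpa using (abs_nonneg _).trans (hr 1 le_rfl)
  have hM : 0 ≤ H + |K| / (lam - 1) := by positivity
  have hc0 : Tendsto (fun n : ℕ => b n - (-(K / ((lam - 1) * n)))) atTop (nhds 0) := by
    have h1 : Tendsto (fun n : ℕ => K / ((lam - 1) * (n : ℝ))) atTop (nhds 0) :=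
      (tendsto_natCast_atTop_atTop.const_mul_atTop hl).const_div_atTop _
    simpa using hb0.add h1
  refine ⟨(H + |K| / (lam - 1)) / (lam - 1), fun n hn =>
    abs_le_div_sq_of_unstable_recurrence
      (s := fun n => r n - K / (lam - 1) / ((n : ℝ) * (n + 1))) hlam hM
      (fun m hm => ?_) (fun m hm => ?_) hc0 hn⟩
  · have hm0 : (0 : ℝ) < m := by exact_mod_cast hm
    simp only [hrec m hm]
    push_cast
    field_simp
    ring
  · have hm0 : (0 : ℝ) < m := by exact_mod_cast hm
    calc |r m - K / (lam - 1) / ((m : ℝ) * (m + 1))|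
        ≤ |r m| + |K / (lam - 1) / ((m : ℝ) * (m + 1))| := abs_sub _ _
      _ = |r m| + |K| / (lam - 1) / ((m : ℝ) * (m + 1)) := by
        rw [abs_div, abs_div, abs_of_pos hl, abs_of_pos (by positivity : (0 : ℝ) < m * (m + 1))]
      _ ≤ H / (m : ℝ) ^ 2 + |K| / (lam - 1) / (m : ℝ) ^ 2 := by
        gcongr
        · exact hr m hm
        · nlinarith
      _ = (H + |K| / (lam - 1)) / (m : ℝ) ^ 2 := (add_div _ _ _).symm
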